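/- arXiv:2409.19465 — 3 statements merged into one kernel-verified Lean document; each statement's English description precedes it below -/
import Mathlib

section
/- Any r-robust graph on 2r vertices contains a clique on ⌊(r+4)/2⌋ vertices. -/
variable {V : Type*}

def rReachable [Fintype V] [DecidableEq V] (G : SimpleGraph V) [DecidableRel G.Adj]
    (S : Finset V) (r : ℕ) : Prop :=
  ∃ i ∈ S, r ≤ (G.neighborFinset i \ S).card

def rRobust [Fintype V] [DecidableEq V] (G : SimpleGraph V) [DecidableRel G.Adj]
    (r : ℕ) : Prop :=
  ∀ S₁ S₂ : Finset V, S₁.Nonempty → S₂.Nonempty → Disjoint S₁ S₂ →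
    rReachable G S₁ r ∨ rReachable G S₂ r

theorem aux_insert [DecidableEq V] (G : SimpleGraph V) (I : Finset V) (v : V)
    (hI : G.IsClique (I : Set V)) (hv : ∀ x ∈ I, G.Adj v x) :
    G.IsClique ((insert v I : Finset V) : Set V) := by
  rw [Finset.coe_insert]
  exact hI.insert (fun b hb _ => hv b hb)

theorem aux_sub (G : SimpleGraph V) (I : Finset V) (n : ℕ)
    (hI : G.IsClique (I : Set V)) (hn : n ≤ I.card) : ∃ C : Finset V, G.IsNClique n C := by
  obtain ⟨C, hC, hcard⟩ := Finset.exists_subset_card_eq hn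
  exact ⟨C, ⟨hI.subset (by exact_mod_cast hC), hcard⟩⟩

/-- A vertex of a set reaching at least as many outside vertices as there are is adjacent
to all of them. -/
theorem aux_full [Fintype V] [DecidableEq V] (G : SimpleGraph V) [DecidableRel G.Adj]
    (S : Finset V) (r : ℕ) (v : V) (h : r ≤ (G.neighborFinset v \ S).card)
    (hS : Sᶜ.card ≤ r) (x : V) (hx : x ∉ S) : G.Adj v x := by
  have hsub : G.neighborFinset v \ S ⊆ Sᶜ := by
    intro y hy
    simp only [Finset.mem_sdiff] at hy
    simpa using hy.2
  have heq := Finset.eq_of_subset_of_card_le hsub (hS.trans h)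
  have : x ∈ G.neighborFinset v \ S := by rw [heq]; simpa using hx
  simpa [hx] using this

theorem aux_grow [Fintype V] [DecidableEq V] (G : SimpleGraph V) [DecidableRel G.Adj]
    (r : ℕ) (hr : 2 ≤ r) (hcard : Fintype.card V = 2 * r)
    (h : rRobust G r) (k : ℕ) (hk : k ≤ r + 2) :
    ∃ I J : Finset V, Disjoint I J ∧ G.IsClique (I : Set V) ∧ G.IsClique (J : Set V) ∧
      I.card + J.card = k := by
  induction k with
  | zero => exact ⟨∅, ∅, by simp⟩
  | succ k ih =>
    obtain ⟨I, J, hd, hI, hJ, hc⟩ := ih (by omega)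
    have hU : (I ∪ J).card = k := by rw [Finset.card_union_of_disjoint hd, hc]
    have hUc : r - 1 ≤ (I ∪ J)ᶜ.card := by rw [Finset.card_compl, hU, hcard]; omega
    obtain ⟨A, hA, hAc⟩ := Finset.exists_subset_card_eq hUc
    have hAcc : Aᶜ.card = r + 1 := by rw [Finset.card_compl, hAc, hcard]; omega
    have hreach : rReachable G A r := by
      rcases h A Aᶜ (Finset.card_pos.1 (by omega)) (Finset.card_pos.1 (by omega))
        disjoint_compl_right with h1 | ⟨v, _, hv⟩
      · exact h1
      · have : (G.neighborFinset v \ Aᶜ) ⊆ A := by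
          intro y hy
          simpa using (Finset.mem_sdiff.1 hy).2
        have := Finset.card_le_card this
        omega
    obtain ⟨v, hvA, hv⟩ := hreach
    have hvU : v ∉ I ∪ J := by simpa using hA hvA
    have hvI : v ∉ I := fun hh => hvU (Finset.mem_union_left _ hh)
    have hvJ : v ∉ J := fun hh => hvU (Finset.mem_union_right _ hh)
    by_cases h1 : ∀ x ∈ I, G.Adj v x
    · refine ⟨insert v I, J, ?_, aux_insert G I v hI h1, hJ, ?_⟩
      · exact Finset.disjoint_insert_left.2 ⟨hvJ, hd⟩
      · rw [Finset.card_insert_of_notMem hvI]; omega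
    by_cases h2 : ∀ x ∈ J, G.Adj v x
    · refine ⟨I, insert v J, ?_, hI, aux_insert G J v hJ h2, ?_⟩
      · exact Finset.disjoint_insert_right.2 ⟨hvI, hd⟩
      · rw [Finset.card_insert_of_notMem hvJ]; omega
    exfalso
    push Not at h1 h2
    obtain ⟨x, hx, hvx⟩ := h1
    obtain ⟨y, hy, hvy⟩ := h2
    have hxy : x ≠ y := fun e => Finset.disjoint_left.1 hd hx (e ▸ hy)
    have hxA : x ∉ A := fun e => by
      have := hA e
      simp [hx] at this
    have hyA : y ∉ A := fun e => by
      have := hA e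
      simp [hy] at this
    have hsub : insert x (insert y (G.neighborFinset v \ A)) ⊆ Aᶜ := by
      intro z hz
      simp only [Finset.mem_insert, Finset.mem_sdiff] at hz
      rw [Finset.mem_compl]
      rcases hz with rfl | rfl | hz
      · exact hxA
      · exact hyA
      · exact hz.2
    have hle := Finset.card_le_card hsub
    rw [Finset.card_insert_of_notMem (by simp [hxy, hvx]),
      Finset.card_insert_of_notMem (by simp [hvy])] at hle
    omega

theorem stmt_9 [Fintype V] [DecidableEq V] (G : SimpleGraph V) [DecidableRel G.Adj]
    (r : ℕ) (hr : 1 ≤ r) (hcard : Fintype.card V = 2 * r)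
    (h : rRobust G r) : ∃ C : Finset V, G.IsNClique ((r + 4) / 2) C := by
  by_contra hno
  have key : ∀ I : Finset V, G.IsClique (I : Set V) → I.card < (r + 4) / 2 := by
    intro I hI
    by_contra hlt
    exact hno (aux_sub G I _ hI (by omega))
  have hIJ : ∃ I J : Finset V, Disjoint I J ∧ G.IsClique (I : Set V) ∧ G.IsClique (J : Set V) ∧
      I.card = (r + 4) / 2 - 1 ∧ J.card = (r + 4) / 2 - 1 ∧ I.card + J.card ≤ 2 * r ∧
      I.card ≤ r := by
    rcases Nat.lt_or_ge r 2 with h1 | h2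
    · have : Nontrivial V := Fintype.one_lt_card_iff_nontrivial.1 (by omega)
      obtain ⟨a, b, hab⟩ := exists_pair_ne V
      exact ⟨{a}, {b}, by simpa using hab, by simp, by simp, by simp; omega, by simp; omega,
        by simp; omega, by simp; omega⟩
    · obtain ⟨I, J, hd, hI, hJ, hc⟩ := aux_grow G r h2 hcard h (r + 2) le_rfl
      have := key I hI
      have := key J hJ
      exact ⟨I, J, hd, hI, hJ, by omega, by omega, by omega, by omega⟩
  obtain ⟨I, J, hd, hI, hJ, hIc, hJc, hle, hIr⟩ := hIJ
  have hUc : r - I.card ≤ (I ∪ J)ᶜ.card := by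
    rw [Finset.card_compl, Finset.card_union_of_disjoint hd, hcard]; omega
  obtain ⟨B, hB, hBc⟩ := Finset.exists_subset_card_eq hUc
  have hIB : Disjoint I B := by
    rw [Finset.disjoint_left]
    intro x hx hxB
    have := hB hxB
    simp [hx] at this
  have hJS : ∀ x ∈ J, x ∉ I ∪ B := by
    intro x hx hxS
    rcases Finset.mem_union.1 hxS with h1 | h1
    · exact Finset.disjoint_left.1 hd h1 hx
    · have := hB h1
      simp [hx] at this
  have hSc : (I ∪ B).card = r := by
    rw [Finset.card_union_of_disjoint hIB, hBc]; omega
  have hScc : (I ∪ B)ᶜ.card = r := by rw [Finset.card_compl, hSc, hcard]; omega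
  rcases h (I ∪ B) (I ∪ B)ᶜ (Finset.card_pos.1 (by omega)) (Finset.card_pos.1 (by omega))
    disjoint_compl_right with ⟨v, hvS, hv⟩ | ⟨v, hvS, hv⟩
  · have := key _ (aux_insert G J v hJ
      (fun x hx => aux_full G _ r v hv hScc.le x (hJS x hx)))
    rw [Finset.card_insert_of_notMem (fun e => hJS v e hvS)] at this
    omega
  · have hvI : v ∉ I := fun e => (Finset.mem_compl.1 hvS) (Finset.mem_union_left _ e)
    have := key _ (aux_insert G I v hI
      (fun x hx => aux_full G _ r v hv (by rw [compl_compl, hSc]) x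
        (by simp [hx])))
    rw [Finset.card_insert_of_notMem hvI] at this
    omega
end

section
/- Any r-robust graph on 2r vertices contains an induced subgraph on r+1 vertices with at least ⌊(r²+2)/2⌋ edges. -/
variable {V : Type*}

namespace RobustAux

open Finset Classical in
/-- number of `H`-neighbours of `v` in `T` -/
noncomputable def dg {V : Type*} (H : SimpleGraph V) (T : Finset V) (v : V) : ℕ :=
  (T.filter (fun w => H.Adj v w)).card

/-- degree sum of `H[T]` -/
noncomputable def ds {V : Type*} (H : SimpleGraph V) (T : Finset V) : ℕ :=
  ∑ u ∈ T, dg H T u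

open Classical in
lemma dg_insert {V : Type*} (H : SimpleGraph V) (T : Finset V) (v u : V) (hv : v ∉ T) :
    dg H (insert v T) u = dg H T u + if H.Adj u v then 1 else 0 := by
  unfold dg
  rw [Finset.filter_insert]
  split_ifs with h
  · rw [Finset.card_insert_of_notMem]
    simp [hv]
  · rfl

open Classical in
lemma dg_mono {V : Type*} (H : SimpleGraph V) {S T : Finset V} (h : S ⊆ T) (u : V) :
    dg H S u ≤ dg H T u :=
  Finset.card_le_card (Finset.filter_subset_filter _ h)

open Classical in
lemma ds_insert {V : Type*} (H : SimpleGraph V) (T : Finset V) (v : V) (hv : v ∉ T) :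
    ds H (insert v T) = ds H T + 2 * dg H T v := by
  unfold ds
  rw [Finset.sum_insert hv, dg_insert H T v v hv, Finset.sum_congr rfl
    (fun u _ => dg_insert H T v u hv), Finset.sum_add_distrib]
  have : (∑ x ∈ T, if H.Adj x v then 1 else 0) = dg H T v := by
    unfold dg
    rw [Finset.card_filter]
    simp [H.adj_comm]
  rw [this]
  simp
  ring

open Classical in
lemma ds_swap {V : Type*} (H : SimpleGraph V) (W : Finset V) (v u : V) (hv : v ∉ W) (hu : u ∈ W) :
    ds H (insert v (W.erase u)) + 2 * dg H W u + 2 * (if H.Adj v u then 1 else 0)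
      = ds H W + 2 * dg H W v := by
  have hu' : u ∉ W.erase u := by simp
  have e : insert u (W.erase u) = W := Finset.insert_erase hu
  have h1 := ds_insert H (W.erase u) u hu'
  have h2 := ds_insert H (W.erase u) v (by simp [hv])
  have h3 := dg_insert H (W.erase u) u u hu'
  have h4 := dg_insert H (W.erase u) u v hu'
  rw [e] at h1 h3 h4
  simp only [SimpleGraph.irrefl, if_false] at h3
  omega

open Classical in
lemma coloring {V : Type*} [Fintype V] (U Q : Finset V) (i a b : V → V)
    (i1 : ∀ u ∈ U, i u ∈ U) (i2 : ∀ u ∈ U, i (i u) = u) (i3 : ∀ u ∈ U, i u ≠ u)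
    (ha : ∀ p ∈ Q, a p ∈ U) (hb : ∀ p ∈ Q, b p ∈ U) (hab : ∀ p ∈ Q, a p ≠ b p) :
    ∃ s : V → Bool, (∀ u ∈ U, s (i u) = !s u) ∧
      2 * (Q.filter (fun p => s (a p) = s (b p))).card ≤ Q.card := by
  let C : Finset (V → Bool) := Finset.univ.filter (fun s => ∀ u ∈ U, s (i u) = !s u)
  have hC : C.Nonempty := by
    let _ : LinearOrder V := linearOrderOfSTO WellOrderingRel
    refine ⟨fun u => decide (u < i u), ?_⟩
    simp only [C, Finset.mem_filter, Finset.mem_univ, true_and]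
    intro u hu
    rw [i2 u hu]
    rcases lt_or_gt_of_ne (i3 u hu) with h | h
    · simp [h, h.le]
    · simp [h, h.le]
  have key : ∀ p ∈ Q, 2 * (C.filter (fun s => s (a p) = s (b p))).card ≤ C.card := by
    intro p hp
    have hs := Finset.card_filter_add_card_filter_not (s := C) (fun s => s (a p) = s (b p))
    have : (C.filter (fun s => s (a p) = s (b p))).card
        ≤ (C.filter (fun s => ¬ s (a p) = s (b p))).card := by
      let f : (V → Bool) → (V → Bool) :=
        fun s w => if w = a p ∨ w = i (a p) then !s w else s w
      have hf : ∀ s, f (f s) = s := by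
        intro s; funext w; simp only [f]; split_ifs <;> simp
      refine Finset.card_le_card_of_injOn f ?_ (fun s _ t _ h => by rw [← hf s, h, hf t])
      intro s hs
      simp only [C, Finset.coe_filter, Finset.mem_filter, Finset.mem_univ, true_and,
        Set.mem_ofPred_eq] at hs ⊢
      obtain ⟨h1, h2⟩ := hs
      have hne : b p ≠ i (a p) := by
        intro h
        rw [h, h1 _ (ha p hp)] at h2
        simp at h2
      refine ⟨?_, ?_⟩
      · intro u hu
        have e : (i u = a p ∨ i u = i (a p)) ↔ (u = a p ∨ u = i (a p)) := by
          constructor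
          · rintro (h | h)
            · right; rw [← h, i2 u hu]
            · left; rw [← i2 u hu, h, i2 _ (ha p hp)]
          · rintro (h | h)
            · right; rw [h]
            · left; rw [h, i2 _ (ha p hp)]
        simp only [f, e, h1 u hu]
        split_ifs <;> rfl
      · simp [f, hne, (hab p hp).symm, h2]
    omega
  by_contra! hcon
  have h1 : ∑ s ∈ C, Q.card < ∑ s ∈ C, 2 * (Q.filter (fun p => s (a p) = s (b p))).card := by
    apply Finset.sum_lt_sum_of_nonempty hC
    intro s hs
    exact hcon s (by simpa [C] using hs)
  have h2 : ∑ s ∈ C, (Q.filter (fun p => s (a p) = s (b p))).card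
      = ∑ p ∈ Q, (C.filter (fun s => s (a p) = s (b p))).card := by
    simp only [Finset.card_filter]
    exact Finset.sum_comm
  have h3 := Finset.sum_le_sum key
  rw [← Finset.mul_sum] at h1 h3
  rw [h2] at h1
  simp only [Finset.sum_const, smul_eq_mul] at h1 h3
  rw [mul_comm] at h1
  rw [mul_comm Q.card] at h3
  nlinarith

open Classical in
lemma matching {V : Type*} [Fintype V] (H : SimpleGraph V) (r : ℕ)
    (hcard : Fintype.card V = 2 * r) (U : Finset V) (hU : U.card = r + 2)
    (h1 : ∀ u ∈ U, dg H U u = 1) (h2 : ∀ p, p ∉ U → 2 ≤ dg H U p) :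
    ∃ S : Finset V, S.card = r ∧ (∀ i ∈ S, ∃ j ∉ S, H.Adj i j) ∧
      (∀ i ∉ S, ∃ j ∈ S, H.Adj i j) := by
  have e1 : ∀ u, ∃ w, u ∈ U → (w ∈ U ∧ H.Adj u w ∧ ∀ w' ∈ U, H.Adj u w' → w' = w) := by
    intro u
    by_cases hu : u ∈ U
    · obtain ⟨w, hw⟩ := Finset.card_eq_one.1 (h1 u hu)
      have hm : ∀ z, (z ∈ U ∧ H.Adj u z) ↔ z = w := by
        intro z
        have := Finset.ext_iff.1 hw z
        simpa using this
      exact ⟨w, fun _ => ⟨((hm w).2 rfl).1, ((hm w).2 rfl).2, fun w' a b => (hm w').1 ⟨a, b⟩⟩⟩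
    · exact ⟨u, fun h => absurd h hu⟩
  choose i hi using e1
  have e2 : ∀ p, ∃ q : V × V, p ∉ U → (q.1 ∈ U ∧ q.2 ∈ U ∧ H.Adj p q.1 ∧ H.Adj p q.2 ∧ q.1 ≠ q.2) := by
    intro p
    by_cases hp : p ∈ U
    · exact ⟨(p, p), fun h => absurd hp h⟩
    · obtain ⟨a, ha, b, hb, hab⟩ := Finset.one_lt_card.1 (h2 p hp)
      simp only [Finset.mem_filter] at ha hb
      exact ⟨(a, b), fun _ => ⟨ha.1, hb.1, ha.2, hb.2, hab⟩⟩
  choose q hq using e2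
  have i2 : ∀ u ∈ U, i (i u) = u := fun u hu =>
    ((hi (i u) (hi u hu).1).2.2 u hu (hi u hu).2.1.symm).symm
  obtain ⟨s, hs, hsQ⟩ := coloring U Uᶜ i (fun p => (q p).1) (fun p => (q p).2)
    (fun u hu => (hi u hu).1) i2
    (fun u hu => (hi u hu).2.1.ne')
    (fun p hp => (hq p (by simpa using hp)).1) (fun p hp => (hq p (by simpa using hp)).2.1)
    (fun p hp => (hq p (by simpa using hp)).2.2.2.2)
  have hUc : Uᶜ.card + U.card = 2 * r := by rw [← hcard, add_comm]; exact Finset.card_add_card_compl U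
  have hA : (U.filter (fun u => s u = true)).card = (U.filter (fun u => ¬ s u = true)).card := by
    refine Finset.card_nbij' i i ?_ ?_ ?_ ?_
    · intro u hu
      simp only [Finset.coe_filter, Set.mem_ofPred_eq] at hu ⊢
      exact ⟨(hi u hu.1).1, by rw [hs u hu.1, hu.2]; simp⟩
    · intro u hu
      simp only [Finset.coe_filter, Set.mem_ofPred_eq] at hu ⊢
      exact ⟨(hi u hu.1).1, by rw [hs u hu.1]; simpa using hu.2⟩
    · intro u hu
      simp only [Finset.coe_filter, Set.mem_ofPred_eq] at hu
      exact i2 u hu.1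
    · intro u hu
      simp only [Finset.coe_filter, Set.mem_ofPred_eq] at hu
      exact i2 u hu.1
  have hA2 := Finset.card_filter_add_card_filter_not (s := U) (fun u => s u = true)
  set A := U.filter (fun u => s u = true) with hAdef
  set Qm := Uᶜ.filter (fun p => s (q p).1 = false ∧ s (q p).2 = false) with hQm
  set Qp := Uᶜ.filter (fun p => s (q p).1 = true ∧ s (q p).2 = true) with hQp
  have hF : Qm.card + Qp.card = (Uᶜ.filter (fun p => s (q p).1 = s (q p).2)).card := by
    rw [← Finset.card_union_of_disjoint]
    · congr 1
      ext p
      simp only [hQm, hQp, Finset.mem_union, Finset.mem_filter]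
      cases s (q p).1 <;> cases s (q p).2 <;> simp
    · rw [Finset.disjoint_left]
      intro p hp hp'
      simp only [hQm, hQp, Finset.mem_filter] at hp hp'
      simp [hp.2.1] at hp'
  have hQpU : Qp ⊆ Uᶜ := Finset.filter_subset _ _
  have c1 : (A ∪ Qm).card = A.card + Qm.card := by
    apply Finset.card_union_of_disjoint
    rw [Finset.disjoint_left]
    intro p hp hp'
    simp only [hQm, hAdef, Finset.mem_filter, Finset.mem_compl] at hp hp'
    exact hp'.1 hp.1
  have c2 : (A ∪ (Uᶜ \ Qp)).card = A.card + (Uᶜ.card - Qp.card) := by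
    rw [← Finset.card_sdiff_of_subset hQpU]
    apply Finset.card_union_of_disjoint
    rw [Finset.disjoint_left]
    intro p hp hp'
    simp only [hAdef, Finset.mem_filter, Finset.mem_compl, Finset.mem_sdiff] at hp hp'
    exact hp'.1 hp.1
  have hsub : A ∪ Qm ⊆ A ∪ (Uᶜ \ Qp) := by
    apply Finset.union_subset_union_right
    intro p hp
    simp only [hQm, hQp, Finset.mem_filter, Finset.mem_compl, Finset.mem_sdiff] at hp ⊢
    simp [hp.1, hp.2.1]
  obtain ⟨S, hS1, hS2, hS3⟩ := Finset.exists_subsuperset_card_eq hsub (n := r)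
    (by omega) (by omega)
  have mU : ∀ u ∈ U, (u ∈ S ↔ s u = true) := by
    intro u hu
    constructor
    · intro h
      have := hS2 h
      simp only [hAdef, Finset.mem_union, Finset.mem_filter, Finset.mem_compl, Finset.mem_sdiff] at this
      tauto
    · intro h
      apply hS1
      simp [hAdef, hu, h]
  refine ⟨S, hS3, ?_, ?_⟩
  · intro p hp
    by_cases hu : p ∈ U
    · refine ⟨i p, ?_, (hi p hu).2.1⟩
      rw [mU _ (hi p hu).1, hs p hu, (mU p hu).1 hp]; simp
    · obtain ⟨q1, q2, q3, q4, _⟩ := hq p hu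
      have := hS2 hp
      simp only [hAdef, hQp, Finset.mem_union, Finset.mem_filter, Finset.mem_compl, Finset.mem_sdiff,
        hu] at this
      by_cases h : s (q p).1 = true
      · exact ⟨_, by rw [mU _ q2]; tauto, q4⟩
      · exact ⟨_, by rwa [mU _ q1], q3⟩
  · intro p hp
    by_cases hu : p ∈ U
    · refine ⟨i p, ?_, (hi p hu).2.1⟩
      have := (mU p hu).not.1 hp
      rw [mU _ (hi p hu).1, hs p hu]; simpa using this
    · obtain ⟨q1, q2, q3, q4, _⟩ := hq p hu
      have : p ∉ A ∪ Qm := fun h => hp (hS1 h)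
      simp only [hAdef, hQm, Finset.mem_union, Finset.mem_filter, Finset.mem_compl,
        hu] at this
      by_cases h : s (q p).1 = true
      · exact ⟨_, by rwa [mU _ q1], q3⟩
      · refine ⟨_, ?_, q4⟩
        rw [mU _ q2]
        simp only [Bool.not_eq_true] at h
        simpa [h] using this

open Classical in
lemma structural {V : Type*} [Fintype V] (H : SimpleGraph V) (r : ℕ) (hr : 2 ≤ r)
    (hcard : Fintype.card V = 2 * r)
    (hbig : ∀ W : Finset V, W.card = r + 1 → r ≤ ds H W)
    (hout : ∀ W : Finset V, W.card = r + 1 → ∃ v ∉ W, dg H W v ≤ 1) :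
    ∃ U : Finset V, U.card = r + 2 ∧
      (∀ u ∈ U, dg H U u = 1) ∧ (∀ p, p ∉ U → 2 ≤ dg H U p) := by
  have hne : ((Finset.univ : Finset V).powersetCard (r+1)).Nonempty := by
    apply Finset.powersetCard_nonempty.2
    rw [Finset.card_univ, hcard]; omega
  obtain ⟨W, hW, hmin⟩ := Finset.exists_min_image _ (ds H) hne
  simp only [Finset.mem_powersetCard, Finset.subset_univ, true_and] at hW hmin
  have swc : ∀ (W' : Finset V) (p u : V), W'.card = r + 1 → p ∉ W' → u ∈ W' →
      (insert p (W'.erase u)).card = r + 1 := by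
    intro W' p u hW' hp hu
    rw [Finset.card_insert_of_notMem (by simp [hp]), Finset.card_erase_of_mem hu]; omega
  have sw : ∀ W' : Finset V, W'.card = r + 1 → ds H W' ≤ ds H W → ∀ p ∉ W', ∀ u ∈ W',
      dg H W' u + (if H.Adj p u then 1 else 0) ≤ dg H W' p := by
    intro W' hW' hle p hp u hu
    have := ds_swap H W' p u hp hu
    have := hmin _ (swc W' p u hW' hp hu)
    omega
  obtain ⟨v, hv, hv1⟩ := hout W hW
  have hWb := hbig W hW
  have hle1 : ∀ u ∈ W, dg H W u ≤ 1 := fun u hu => by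
    have := sw W hW le_rfl v hv u hu
    omega
  have hv2 : dg H W v = 1 := by
    by_contra hcon
    have : ds H W = 0 := by
      apply Finset.sum_eq_zero
      intro u hu
      have := sw W hW le_rfl v hv u hu
      omega
    omega
  obtain ⟨x, hx⟩ := Finset.card_eq_one.1 hv2
  have hxm : ∀ z, (z ∈ W ∧ H.Adj v z) ↔ z = x := by
    intro z
    have := Finset.ext_iff.1 hx z
    simpa using this
  obtain ⟨hxW, hvx⟩ := (hxm x).2 rfl
  have hx0 : dg H W x = 0 := by
    have := sw W hW le_rfl v hv x hxW
    simp only [hvx, if_true] at this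
    omega
  have hds : ds H W = ∑ u ∈ W.erase x, dg H W u := by
    unfold ds
    rw [← Finset.add_sum_erase W _ hxW, hx0, zero_add]
  have hec : (W.erase x).card = r := by rw [Finset.card_erase_of_mem hxW]; omega
  have hone : ∀ u ∈ W.erase x, dg H W u = 1 := by
    have hle : ∀ u ∈ W.erase x, dg H W u ≤ 1 := fun u hu => hle1 u (Finset.mem_of_mem_erase hu)
    apply (Finset.sum_eq_sum_iff_of_le hle).1
    apply le_antisymm (Finset.sum_le_sum hle)
    rw [← hds]; simpa [hec] using hWb
  have hUx : ∀ u, dg H (insert v W) u = dg H W u + if H.Adj u v then 1 else 0 :=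
    fun u => dg_insert H W v u hv
  refine ⟨insert v W, by rw [Finset.card_insert_of_notMem hv]; omega, ?_, ?_⟩
  · intro u hu
    rw [hUx]
    rcases Finset.mem_insert.1 hu with rfl | hu
    · simp [hv2]
    · by_cases hux : u = x
      · subst hux; simp [hx0, hvx.symm]
      · rw [hone u (by simp [hu, hux]), if_neg]
        intro h
        exact hux ((hxm u).1 ⟨hu, h.symm⟩)
  · intro p hp
    simp only [Finset.mem_insert, not_or] at hp
    by_contra hlt
    have hpW : dg H W p ≤ 1 := by
      have := hUx p
      omega
    have hnot : ∀ u ∈ W.erase x, ¬ H.Adj p u := by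
      intro u hu h
      have := sw W hW le_rfl p hp.2 u (Finset.mem_of_mem_erase hu)
      rw [hone u hu, if_pos h] at this
      omega
    obtain ⟨u, hu⟩ : (W.erase x).Nonempty := by rw [← Finset.card_pos]; omega
    have huW := Finset.mem_of_mem_erase hu
    have hux := Finset.ne_of_mem_erase hu
    have hp1 : 1 ≤ dg H W p := by
      have := sw W hW le_rfl p hp.2 u huW
      rw [hone u hu] at this
      omega
    have hpx : H.Adj p x := by
      obtain ⟨z, hz⟩ := Finset.card_pos.1 hp1
      simp only [Finset.mem_filter] at hz
      by_cases hzx : z = x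
      · exact hzx ▸ hz.2
      · exact absurd hz.2 (hnot z (by simp [hz.1, hzx]))
    have hW1 := swc W v u hW hv huW
    have hle : ds H (insert v (W.erase u)) ≤ ds H W := by
      have := ds_swap H W v u hv huW
      rw [hone u hu, hv2] at this
      omega
    have h3 := sw _ hW1 hle p (by simp [hp.1, hp.2]) x (by simp [hxW, Ne.symm hux])
    rw [if_pos hpx] at h3
    have h4 : 1 ≤ dg H (insert v (W.erase u)) x := by
      apply Finset.card_pos.2
      exact ⟨v, by simp [hvx.symm]⟩
    have h5 : dg H (insert v (W.erase u)) p ≤ dg H (insert v W) p :=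
      dg_mono H (Finset.insert_subset_insert _ (Finset.erase_subset _ _)) p
    omega

open Classical in
lemma edges {V : Type*} [Fintype V] (G : SimpleGraph V) (W : Finset V) (r : ℕ)
    (hW : W.card = r + 1) :
    2 * (G.induce (↑W : Set V)).edgeSet.ncard + ds Gᶜ W = r * (r + 1) := by
  have h1 : 2 * (G.induce (↑W : Set V)).edgeSet.ncard = ∑ u ∈ W, dg G W u := by
    rw [← SimpleGraph.coe_edgeFinset, Set.ncard_coe_finset,
      ← SimpleGraph.sum_degrees_eq_twice_card_edges]
    rw [← Finset.sum_coe_sort W]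
    apply Finset.sum_congr rfl
    intro u _
    unfold dg
    rw [← SimpleGraph.card_neighborFinset_eq_degree]
    refine Finset.card_bij (fun a _ => a.1) ?_ ?_ ?_
    · intro a ha
      have : G.Adj u.1 a.1 := by simpa using ha
      simp only [Finset.mem_filter]
      exact ⟨a.2, this⟩
    · intro a _ b _ h
      exact Subtype.ext h
    · intro b hb
      simp only [Finset.mem_filter] at hb
      exact ⟨⟨b, hb.1⟩, by simpa using hb.2, rfl⟩
  rw [h1]
  unfold ds
  rw [← Finset.sum_add_distrib]
  have : ∀ u ∈ W, dg G W u + dg Gᶜ W u = r := by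
    intro u hu
    unfold dg
    rw [← Finset.card_union_of_disjoint]
    · refine (congrArg Finset.card (a₂ := W.erase u) ?_).trans ?_
      · ext w
        simp only [Finset.mem_union, Finset.mem_filter, SimpleGraph.compl_adj, Finset.mem_erase]
        constructor
        · rintro (h | h)
          · exact ⟨h.2.ne', h.1⟩
          · exact ⟨Ne.symm h.2.1, h.1⟩
        · rintro ⟨h, h'⟩
          by_cases hg : G.Adj u w
          · exact Or.inl ⟨h', hg⟩
          · exact Or.inr ⟨h', Ne.symm h, hg⟩
      · rw [Finset.card_erase_of_mem hu]; omega
    · rw [Finset.disjoint_left]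
      intro w hw hw'
      simp only [Finset.mem_filter, SimpleGraph.compl_adj] at hw hw'
      exact hw'.2.2 hw.2
  rw [Finset.sum_congr rfl this]
  simp [hW, mul_comm]

end RobustAux

theorem stmt_10 [Fintype V] [DecidableEq V] (G : SimpleGraph V) [DecidableRel G.Adj]
    (r : ℕ) (hr : 1 ≤ r) (hcard : Fintype.card V = 2 * r)
    (h : rRobust G r) :
    ∃ W : Finset V, W.card = r + 1 ∧
      (r ^ 2 + 2) / 2 ≤ (G.induce (↑W : Set V)).edgeSet.ncard := by
  by_contra! hcon
  have hbig : ∀ W : Finset V, W.card = r + 1 → r ≤ RobustAux.ds Gᶜ W := by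
    intro W hW
    have h1 := RobustAux.edges G W r hW
    have h2 := hcon W hW
    have h3 : r * (r + 1) = r ^ 2 + r := by ring
    omega
  -- balanced partitions
  have nobal : ∀ S : Finset V, S.card = r → (∀ i ∈ S, ∃ j ∉ S, Gᶜ.Adj i j) →
      (∀ i ∉ S, ∃ j ∈ S, Gᶜ.Adj i j) → False := by
    intro S hS h1 h2
    have hc : S.card + Sᶜ.card = 2 * r := by rw [← hcard]; exact Finset.card_add_card_compl S
    have gen : ∀ T : Finset V, Tᶜ.card = r → (∀ i ∈ T, ∃ j ∉ T, Gᶜ.Adj i j) →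
        ¬ rReachable G T r := by
      rintro T hT hT1 ⟨i, hi, hi2⟩
      obtain ⟨j, hj, hij⟩ := hT1 i hi
      have : G.neighborFinset i \ T ⊂ Tᶜ := by
        rw [Finset.ssubset_iff_of_subset]
        · refine ⟨j, by simpa using hj, ?_⟩
          simp only [Finset.mem_sdiff, SimpleGraph.mem_neighborFinset]
          exact fun hh => hij.2 hh.1
        · intro z hz
          simp only [Finset.mem_sdiff] at hz
          simpa using hz.2
      have := Finset.card_lt_card this
      omega
    rcases h S Sᶜ (Finset.card_pos.1 (by omega)) (Finset.card_pos.1 (by omega))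
      disjoint_compl_right with hh | hh
    · exact gen S (by omega) h1 hh
    · refine gen Sᶜ (by rw [compl_compl]; exact hS) ?_ hh
      intro i hi
      obtain ⟨j, hj, hij⟩ := h2 i (by simpa using hi)
      exact ⟨j, by simpa using hj, hij⟩
  by_cases hr2 : 2 ≤ r
  · have hout : ∀ W : Finset V, W.card = r + 1 → ∃ v ∉ W, RobustAux.dg Gᶜ W v ≤ 1 := by
      intro W hW
      have hc : W.card + Wᶜ.card = 2 * r := by rw [← hcard]; exact Finset.card_add_card_compl W
      rcases h W Wᶜ (Finset.card_pos.1 (by omega)) (Finset.card_pos.1 (by omega))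
        disjoint_compl_right with hh | hh
      · obtain ⟨i, hi, hi2⟩ := hh
        have : G.neighborFinset i \ W ⊆ Wᶜ := by
          intro z hz
          simp only [Finset.mem_sdiff] at hz
          simpa using hz.2
        have := Finset.card_le_card this
        omega
      · obtain ⟨i, hi, hi2⟩ := hh
        refine ⟨i, by simpa using hi, ?_⟩
        obtain ⟨Z, hZ, hZm⟩ : ∃ Z : Finset V, RobustAux.dg Gᶜ W i = Z.card ∧
            ∀ z, z ∈ Z ↔ z ∈ W ∧ Gᶜ.Adj i z :=
          ⟨_, rfl, fun z => @Finset.mem_filter _ _ (_) _ _⟩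
        rw [hZ]
        have hd : Disjoint (G.neighborFinset i \ Wᶜ) Z := by
          rw [Finset.disjoint_left]
          intro z hz hz'
          simp only [Finset.mem_sdiff, SimpleGraph.mem_neighborFinset, hZm,
            SimpleGraph.compl_adj] at hz hz'
          exact hz'.2.2 hz.1
        have hs : (G.neighborFinset i \ Wᶜ) ∪ Z ⊆ W := by
          intro z hz
          simp only [Finset.mem_union, Finset.mem_sdiff, Finset.mem_compl, not_not,
            hZm] at hz
          rcases hz with hz | hz
          · exact hz.2
          · exact hz.1
        have := Finset.card_le_card hs
        rw [Finset.card_union_of_disjoint hd] at this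
        omega
    obtain ⟨U, hU, h1, h2⟩ := RobustAux.structural Gᶜ r hr2 hcard hbig hout
    obtain ⟨S, a, b, c⟩ := RobustAux.matching Gᶜ r hcard U hU h1 h2
    exact nobal S a b c
  · obtain rfl : r = 1 := by omega
    have h0 := hbig Finset.univ (by rw [Finset.card_univ, hcard])
    have : ∃ a b, Gᶜ.Adj a b := by
      by_contra! hno
      have : RobustAux.ds Gᶜ (Finset.univ : Finset V) = 0 := by
        apply Finset.sum_eq_zero
        intro u _
        simp only [RobustAux.dg, Finset.card_eq_zero, Finset.filter_eq_empty_iff]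
        exact fun _ _ => hno _ _
      omega
    obtain ⟨a, b, hab⟩ := this
    have huniv : ({a, b} : Finset V) = Finset.univ := by
      apply Finset.eq_univ_of_card
      rw [Finset.card_pair hab.ne, hcard]
    refine nobal {a} (by simp) ?_ ?_
    · intro i hi
      obtain rfl := Finset.mem_singleton.1 hi
      exact ⟨b, by simpa using hab.ne', hab⟩
    · intro i hi
      have : i ∈ ({a, b} : Finset V) := by rw [huniv]; simp
      simp only [Finset.mem_insert, Finset.mem_singleton] at this hi
      rcases this with h | h
      · exact absurd h hi
      · exact ⟨a, by simp, h ▸ hab.symm⟩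
end

section
/- Any r-robust graph on 2r vertices has at least ⌊(r(3r−2)+2)/2⌋ edges. -/
variable {V : Type*}

namespace Rob

open Classical in
/-- number of neighbours of `v` in `P` -/
noncomputable def d (H : SimpleGraph V) (v : V) (P : Finset V) : ℕ := (P.filter (H.Adj v)).card

/-- twice the number of edges inside `P` -/
noncomputable def E2 (H : SimpleGraph V) (P : Finset V) : ℕ := ∑ v ∈ P, d H v P

def Cond [DecidableEq V] (H : SimpleGraph V) (P : Finset V) (r : ℕ) : Prop :=
  ∀ T ⊆ P, T.Nonempty → T.card < r → ∃ v ∈ T, d H v (P \ T) + T.card ≤ r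

def Good [DecidableEq V] (H : SimpleGraph V) (P A : Finset V) : Prop :=
  (∀ v ∈ A, ∃ u ∈ P \ A, H.Adj v u) ∧ (∀ v ∈ P \ A, ∃ u ∈ A, H.Adj v u)

lemma d_mono (H : SimpleGraph V) (v : V) {P Q : Finset V} (h : P ⊆ Q) : d H v P ≤ d H v Q := by
  classical
  exact Finset.card_le_card (Finset.filter_subset_filter _ h)

lemma d_pos (H : SimpleGraph V) (v u : V) (P : Finset V) (hu : u ∈ P) (h : H.Adj v u) :
    0 < d H v P := by
  classical
  exact Finset.card_pos.mpr ⟨u, Finset.mem_filter.mpr ⟨hu, h⟩⟩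

lemma d_insert [DecidableEq V] (H : SimpleGraph V) (v w : V) (P : Finset V) (hw : w ∉ P) :
    d H v (insert w P) = d H v P + (by classical exact if H.Adj v w then 1 else 0) := by
  classical
  unfold d
  rw [Finset.filter_insert]
  split_ifs with h
  · rw [Finset.card_insert_of_notMem (by simp [hw])]
  · rfl

lemma E2_insert [DecidableEq V] (H : SimpleGraph V) (w : V) (P : Finset V) (hw : w ∉ P) :
    E2 H (insert w P) = E2 H P + 2 * d H w P := by
  classical
  unfold E2
  rw [Finset.sum_insert hw, d_insert H w w P hw]
  have : ∑ v ∈ P, d H v (insert w P) = ∑ v ∈ P, d H v P + d H w P := by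
    rw [Finset.sum_congr rfl (fun v _ => d_insert H v w P hw), Finset.sum_add_distrib]
    congr 1
    unfold d
    rw [Finset.card_filter]
    apply Finset.sum_congr rfl
    intro v _
    simp only [H.adj_comm]
  rw [this]
  simp
  ring

lemma inc_bound [DecidableEq V] (H : SimpleGraph V) (P : Finset V) (r : ℕ) (hc : Cond H P r)
    (hd : ∀ v ∈ P, d H v P + 2 ≤ r) :
    ∀ k, ∀ T ⊆ P, T.card = k + 1 → k + 1 < r →
      E2 H P + 2 + (k + 1) * (k + 2) ≤ E2 H (P \ T) + 2 * r * (k + 1) := by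
  intro k
  induction k with
  | zero =>
    intro T hT hk hr
    obtain ⟨v, rfl⟩ := Finset.card_eq_one.mp hk
    have hv : v ∈ P := by simpa using hT
    have h1 := E2_insert H v (P \ {v}) (by simp)
    have h2 : insert v (P \ {v}) = P := by ext x; simp; grind
    rw [h2] at h1
    have h3 := hd v hv
    have h4 := d_mono H v (Finset.sdiff_subset : P \ {v} ⊆ P)
    omega
  | succ k ih =>
    intro T hT hk hr
    obtain ⟨v, hv, hle⟩ := hc T hT (Finset.card_pos.mp (by omega)) (by omega)
    have h0 := ih (T.erase v) ((Finset.erase_subset _ _).trans hT)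
      (by rw [Finset.card_erase_of_mem hv]; omega) (by omega)
    have h2 : insert v (P \ T) = P \ T.erase v := by
      ext x; have := hT hv; simp; grind
    have h1 := E2_insert H v (P \ T) (by simp [hv])
    rw [h2] at h1
    rw [h1] at h0
    rw [hk] at hle
    nlinarith

lemma exists_matching [DecidableEq V] (H : SimpleGraph V) (P : Finset V) (r : ℕ) (hr : 2 ≤ r)
    (hn : r ≤ P.card) (hc : Cond H P r) :
    ∃ U ⊆ P, U.card + r = P.card + 1 ∧ E2 H U ≤ U.card := by
  have hne : (P.powersetCard (P.card + 1 - r)).Nonempty :=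
    Finset.powersetCard_nonempty.mpr (by omega)
  obtain ⟨U, hU, hmin⟩ := Finset.exists_min_image _ (E2 H) hne
  rw [Finset.mem_powersetCard] at hU
  refine ⟨U, hU.1, by omega, ?_⟩
  have hTc : (P \ U).card = r - 1 := by
    rw [Finset.card_sdiff_of_subset hU.1]; omega
  obtain ⟨v, hv, hle⟩ := hc (P \ U) Finset.sdiff_subset (Finset.card_pos.mp (by omega)) (by omega)
  rw [Finset.sdiff_sdiff_eq_self hU.1] at hle
  have hv' := Finset.mem_sdiff.mp hv
  unfold E2
  rw [Finset.card_eq_sum_ones]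
  apply Finset.sum_le_sum
  intro u hu
  have h1 := E2_insert H u (U.erase u) (by simp)
  have h2 := E2_insert H v (U.erase u) (by simp [hv'.2])
  have h3 := hmin (insert v (U.erase u)) (by
    rw [Finset.mem_powersetCard]
    constructor
    · intro x hx
      rcases Finset.mem_insert.mp hx with rfl | hx
      · exact hv'.1
      · exact hU.1 (Finset.mem_of_mem_erase hx)
    · rw [Finset.card_insert_of_notMem (by simp [hv'.2]), Finset.card_erase_of_mem hu]
      have := Finset.card_pos.mpr ⟨u, hu⟩
      omega)
  have h4 := d_insert H u u (U.erase u) (by simp)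
  rw [Finset.insert_erase hu] at h1 h4
  simp at h4
  have h5 := d_mono H v (Finset.erase_subset u U)
  omega

lemma exists_big [DecidableEq V] (H : SimpleGraph V) (P : Finset V) (r : ℕ) (hr : 2 ≤ r)
    (hn : r ≤ P.card) (hc : Cond H P r) (hm : r * r + P.card ≤ E2 H P + 2 * r) :
    ∃ w ∈ P, r ≤ d H w P + 1 := by
  by_contra! hcon
  obtain ⟨U, hU, hUc, hE⟩ := exists_matching H P r hr hn hc
  obtain ⟨k, rfl⟩ : ∃ k, r = k + 2 := ⟨r - 2, by omega⟩
  have := inc_bound H P (k + 2) hc (fun v hv => by have := hcon v hv; omega) k (P \ U)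
    Finset.sdiff_subset (by rw [Finset.card_sdiff_of_subset hU]; omega) (by omega)
  rw [Finset.sdiff_sdiff_eq_self hU] at this
  nlinarith

lemma match_cut [DecidableEq V] (H : SimpleGraph V) : ∀ n, ∀ P : Finset V, P.card = n →
    (∀ v ∈ P, d H v P = 1) → ∃ A ⊆ P, A.card = P.card / 2 ∧ Good H P A := by
  classical
  intro n
  induction n using Nat.strong_induction_on with
  | _ n ih =>
  intro P hP hd
  rcases P.eq_empty_or_nonempty with rfl | ⟨v, hv⟩
  · exact ⟨∅, by simp, by simp, by simp [Good]⟩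
  have huniq : ∀ x ∈ P, ∃ y ∈ P, H.Adj x y ∧ ∀ z ∈ P, H.Adj x z → z = y := by
    intro x hx
    obtain ⟨y, hy⟩ := Finset.card_eq_one.mp (hd x hx)
    have h1 : ∀ z, z ∈ P.filter (H.Adj x) ↔ z = y := by simp [hy]
    simp only [Finset.mem_filter] at h1
    exact ⟨y, ((h1 y).2 rfl).1, ((h1 y).2 rfl).2, fun z hz ha => (h1 z).1 ⟨hz, ha⟩⟩
  obtain ⟨u, hu, hvu, hvq⟩ := huniq v hv
  have huq : ∀ z ∈ P, H.Adj u z → z = v := by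
    obtain ⟨y, hy, _, hq⟩ := huniq u hu
    intro z hz ha
    rw [hq z hz ha, hq v hv hvu.symm]
  have hne : v ≠ u := hvu.ne
  have hcard : ((P.erase v).erase u).card + 2 = P.card := by
    rw [Finset.card_erase_of_mem (by simp [hu, hne.symm]), Finset.card_erase_of_mem hv]
    have : 1 < P.card := Finset.one_lt_card.mpr ⟨v, hv, u, hu, hne⟩
    omega
  obtain ⟨A, hA, hAc, hG⟩ := ih _ (by omega) ((P.erase v).erase u) rfl (by
    intro x hx
    simp only [Finset.mem_erase] at hx
    rw [← hd x hx.2.2]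
    unfold d
    congr 1
    ext z
    simp only [Finset.mem_filter, Finset.mem_erase]
    constructor
    · rintro ⟨⟨_, _, h⟩, h'⟩; exact ⟨h, h'⟩
    · rintro ⟨h, h'⟩
      refine ⟨⟨?_, ?_, h⟩, h'⟩
      · rintro rfl; exact hx.2.1 (huq x hx.2.2 h'.symm)
      · rintro rfl; exact hx.1 (hvq x hx.2.2 h'.symm))
  have hvA : v ∉ A := fun h => by simpa using hA h
  have huA : u ∉ A := fun h => by simpa using hA h
  refine ⟨insert v A, ?_, ?_, ?_, ?_⟩
  · intro x hx
    rcases Finset.mem_insert.mp hx with rfl | hx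
    · exact hv
    · have := hA hx; simp at this; exact this.2.2
  · rw [Finset.card_insert_of_notMem hvA]; omega
  · intro x hx
    rcases Finset.mem_insert.mp hx with rfl | hx
    · exact ⟨u, by simp [hu, huA, hne.symm], hvu⟩
    · obtain ⟨y, hy, ha⟩ := hG.1 x hx
      refine ⟨y, ?_, ha⟩
      simp at hy ⊢; tauto
  · intro x hx
    by_cases hxu : x = u
    · subst hxu; exact ⟨v, by simp, hvu.symm⟩
    · obtain ⟨y, hy, ha⟩ := hG.2 x (by simp at hx ⊢; tauto)
      exact ⟨y, by simp [hy], ha⟩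

lemma deg_le [DecidableEq V] (H : SimpleGraph V) (P : Finset V) (r : ℕ) (hr : 2 ≤ r)
    (hc : Cond H P r) (v : V) (hv : v ∈ P) : d H v P + 1 ≤ r := by
  obtain ⟨x, hx, hle⟩ := hc {v} (by simpa using hv) (by simp) (by simp; omega)
  simp at hx
  subst hx
  have h4 := d_insert H x x (P \ {x}) (by simp)
  have h2 : insert x (P \ {x}) = P := by ext y; simp; grind
  rw [h2] at h4
  simp at h4 hle
  omega

lemma main [DecidableEq V] (H : SimpleGraph V) : ∀ k, ∀ P : Finset V, k + 2 ≤ P.card →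
    Cond H P (k + 2) → (k + 2) * (k + 2) + P.card ≤ E2 H P + 2 * (k + 2) →
    ∃ A ⊆ P, A.card = P.card / 2 ∧ Good H P A := by
  classical
  intro k
  induction k with
  | zero =>
    intro P _ hc hm
    apply match_cut H _ P rfl
    have hle : ∀ v ∈ P, d H v P ≤ 1 := fun v hv => by
      have := deg_le H P 2 le_rfl hc v hv
      omega
    have hs : ∑ v ∈ P, d H v P = ∑ v ∈ P, 1 := by
      apply le_antisymm (Finset.sum_le_sum hle)
      rw [← Finset.card_eq_sum_ones]
      unfold E2 at hm
      omega
    exact (Finset.sum_eq_sum_iff_of_le hle).mp hs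
  | succ k ih =>
    intro P hn hc hm
    obtain ⟨w, hw, hbig⟩ := exists_big H P _ (by omega) hn hc hm
    have hdw := deg_le H P _ (by omega) hc w hw
    have hins : insert w (P.erase w) = P := Finset.insert_erase hw
    have hself := d_insert H w w (P.erase w) (by simp)
    have hE := E2_insert H w (P.erase w) (by simp)
    rw [hins] at hself hE
    simp at hself
    have hcard : (P.erase w).card + 1 = P.card := Finset.card_erase_add_one hw
    obtain ⟨A, hA, hAc, hG⟩ := ih (P.erase w) (by omega) (by
      intro T hT hTn hTc
      have hwT : w ∉ T := fun h => by simpa using hT h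
      have hTP : T ⊆ P := hT.trans (Finset.erase_subset _ _)
      have hsub : P.erase w \ T = P \ insert w T := by
        ext x; simp; tauto
      obtain ⟨v, hv, hle⟩ := hc (insert w T) (Finset.insert_subset hw hTP) (by simp)
        (by rw [Finset.card_insert_of_notMem hwT]; omega)
      rw [Finset.card_insert_of_notMem hwT] at hle
      rcases Finset.mem_insert.mp hv with rfl | hv
      · -- w is adjacent to everything in T
        have hsplit : d H v P ≤ d H v (P \ insert v T) + (T.filter (H.Adj v)).card := by
          unfold d
          refine le_trans (Finset.card_le_card ?_) (Finset.card_union_le _ _)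
          intro x hx
          simp only [Finset.mem_filter] at hx
          simp only [Finset.mem_union, Finset.mem_filter, Finset.mem_sdiff, Finset.mem_insert]
          have := hx.2.ne
          grind
        have hfull : T.filter (H.Adj v) = T := by
          apply Finset.eq_of_subset_of_card_le (Finset.filter_subset _ _)
          omega
        obtain ⟨x, hx, hxle⟩ := hc T hTP hTn (by omega)
        refine ⟨x, hx, ?_⟩
        have hadj : H.Adj v x := by
          rw [← hfull] at hx
          exact (Finset.mem_filter.mp hx).2
        have h1 := d_insert H x v (P.erase v \ T) (by simp)
        have h2 : insert v (P.erase v \ T) = P \ T := by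
          ext y; simp; grind
        rw [h2] at h1
        simp [hadj.symm] at h1
        omega
      · refine ⟨v, hv, ?_⟩
        rw [hsub]
        omega) (by nlinarith)
    have hwA : w ∉ A := fun h => by simpa using hA h
    have hNc : (P.filter (H.Adj w)).card = k + 2 := by
      have : d H w P = k + 2 := by omega
      exact this
    -- the neighbourhood of w is not inside one side of the cut
    have key : ∀ Z ⊆ P.erase w, (∀ v ∈ Z, ∃ u ∈ P.erase w \ Z, H.Adj v u) →
        ∃ x ∈ P.erase w \ Z, H.Adj w x := by
      intro Z hZ hZG
      by_contra! hcon
      have hNZ : P.filter (H.Adj w) ⊆ Z := by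
        intro x hx
        simp only [Finset.mem_filter] at hx
        by_contra hxZ
        exact hcon x (by simp [hxZ, hx.1, hx.2.ne.symm]) hx.2
      obtain ⟨v, hv, hle⟩ := hc (P.filter (H.Adj w)) (Finset.filter_subset _ _)
        (Finset.card_pos.mp (by omega)) (by omega)
      obtain ⟨u, hu, hvu⟩ := hZG v (hNZ hv)
      simp only [Finset.mem_sdiff, Finset.mem_erase] at hu
      have : 1 < d H v (P \ P.filter (H.Adj w)) := by
        unfold d
        apply Finset.one_lt_card.mpr
        refine ⟨w, ?_, u, ?_, hu.1.1.symm⟩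
        · simp only [Finset.mem_filter, Finset.mem_sdiff] at hv ⊢
          exact ⟨⟨hw, by simp⟩, hv.2.symm⟩
        · rw [Finset.mem_filter, Finset.mem_sdiff]
          exact ⟨⟨hu.1.2, fun h => hu.2 (hNZ h)⟩, hvu⟩
      omega
    obtain ⟨b, hb, hwb⟩ := key A hA hG.1
    obtain ⟨a, ha, hwa⟩ := key (P.erase w \ A) Finset.sdiff_subset (by
      rw [Finset.sdiff_sdiff_eq_self hA]; exact hG.2)
    rw [Finset.sdiff_sdiff_eq_self hA] at ha
    have hAP : A ⊆ P := hA.trans (Finset.erase_subset _ _)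
    simp only [Finset.mem_sdiff, Finset.mem_erase] at hb
    by_cases hpar : (P.erase w).card % 2 = 0
    · refine ⟨A, hAP, by omega, ?_, ?_⟩
      · intro x hx
        obtain ⟨y, hy, hxy⟩ := hG.1 x hx
        refine ⟨y, ?_, hxy⟩
        simp at hy ⊢; tauto
      · intro x hx
        by_cases hxw : x = w
        · subst hxw; exact ⟨a, ha, hwa⟩
        · exact hG.2 x (by simp at hx ⊢; tauto)
    · refine ⟨insert w A, Finset.insert_subset hw hAP, ?_, ?_, ?_⟩
      · rw [Finset.card_insert_of_notMem hwA]; omega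
      · intro x hx
        rcases Finset.mem_insert.mp hx with rfl | hx
        · exact ⟨b, by simp; tauto, hwb⟩
        · obtain ⟨y, hy, hxy⟩ := hG.1 x hx
          refine ⟨y, ?_, hxy⟩
          simp at hy ⊢; tauto
      · intro x hx
        obtain ⟨y, hy, hxy⟩ := hG.2 x (by simp at hx ⊢; tauto)
        exact ⟨y, by simp [hy], hxy⟩

lemma compl_card [Fintype V] [DecidableEq V] (G : SimpleGraph V) [DecidableRel G.Adj]
    (v : V) (T : Finset V) (hv : v ∈ T) :
    d Gᶜ v (Finset.univ \ T) + (G.neighborFinset v \ T).card + T.card = Fintype.card V := by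
  classical
  rw [← Finset.card_univ, ← Finset.card_sdiff_add_card_eq_card (Finset.subset_univ T)]
  have h1 := Finset.card_filter_add_card_filter_not (s := Finset.univ \ T) (fun x => Gᶜ.Adj v x)
  have h2 : Finset.filter (fun x => ¬ Gᶜ.Adj v x) (Finset.univ \ T) = G.neighborFinset v \ T := by
    ext x
    simp only [Finset.mem_sdiff, Finset.mem_filter, SimpleGraph.mem_neighborFinset,
      SimpleGraph.compl_adj, Finset.mem_univ, true_and]
    have : x ∉ T → v ≠ x := by rintro h rfl; exact h hv
    tauto
  rw [h2] at h1
  have h3 : d Gᶜ v (Finset.univ \ T) =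
      (Finset.filter (fun x => Gᶜ.Adj v x) (Finset.univ \ T)).card := by
    unfold d
    congr
  rw [h3, h1]

end Rob

theorem stmt_11 [Fintype V] [DecidableEq V] (G : SimpleGraph V) [DecidableRel G.Adj]
    (r : ℕ) (hr : 1 ≤ r) (hcard : Fintype.card V = 2 * r)
    (h : rRobust G r) : (r * (3 * r - 2) + 2) / 2 ≤ G.edgeFinset.card := by
  classical
  by_contra! hlt
  -- a good balanced cut of the complement contradicts robustness
  have hcut : ∀ A : Finset V, A.card = r → ¬ Rob.Good Gᶜ Finset.univ A := by
    intro A hA hG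
    have hB : (Finset.univ \ A).card = r := by
      rw [Finset.card_sdiff_of_subset (Finset.subset_univ _), Finset.card_univ]; omega
    have hno : ∀ Z : Finset V, Z.card = r → (∀ v ∈ Z, ∃ u ∈ Finset.univ \ Z, Gᶜ.Adj v u) →
        ¬ rReachable G Z r := by
      rintro Z hZ hZG ⟨v, hv, hvr⟩
      have h1 := Rob.compl_card G v Z hv
      obtain ⟨u, hu, hvu⟩ := hZG v hv
      have : 0 < Rob.d Gᶜ v (Finset.univ \ Z) :=
        Rob.d_pos Gᶜ v u _ hu hvu
      omega
    rcases h A (Finset.univ \ A) (Finset.card_pos.mp (by omega)) (Finset.card_pos.mp (by omega))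
      Finset.disjoint_sdiff with h1 | h1
    · exact hno A hA hG.1 h1
    · refine hno _ hB ?_ h1
      rw [Finset.sdiff_sdiff_eq_self (Finset.subset_univ _)]
      exact hG.2
  have hcond : Rob.Cond Gᶜ Finset.univ r := by
    intro T _ hTn hTr
    have hB : (Finset.univ \ T).card + T.card = 2 * r := by
      rw [Finset.card_sdiff_add_card_eq_card (Finset.subset_univ T), Finset.card_univ, hcard]
    rcases h T (Finset.univ \ T) hTn (Finset.card_pos.mp (by omega))
      Finset.disjoint_sdiff with ⟨v, hv, hvr⟩ | ⟨v, hv, hvr⟩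
    · refine ⟨v, hv, ?_⟩
      have := Rob.compl_card G v T hv
      omega
    · have : (G.neighborFinset v \ (Finset.univ \ T)).card ≤ T.card := by
        apply Finset.card_le_card
        intro x hx
        simpa using (Finset.mem_sdiff.mp hx).2
      omega
  have hE : Rob.E2 Gᶜ Finset.univ + 2 * G.edgeFinset.card + 2 * r = 2 * r * (2 * r) := by
    rw [← SimpleGraph.sum_degrees_eq_twice_card_edges]
    have h1 : ∀ v : V, Rob.d Gᶜ v Finset.univ + G.degree v + 1 = 2 * r := by
      intro v
      have h2 := Rob.compl_card G v {v} (by simp)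
      have h3 : G.neighborFinset v \ {v} = G.neighborFinset v := by
        ext x; simp; rintro h rfl; exact G.loopless.irrefl _ h
      have h4 := Rob.d_insert Gᶜ v v (Finset.univ \ {v}) (by simp)
      have h5 : insert v (Finset.univ \ {v}) = (Finset.univ : Finset V) := by ext y; simp
      rw [h5] at h4
      simp at h4
      rw [h3, SimpleGraph.card_neighborFinset_eq_degree] at h2
      simp at h2
      omega
    have h2 : ∑ v : V, (Rob.d Gᶜ v Finset.univ + G.degree v + 1) = ∑ v : V, 2 * r :=
      Finset.sum_congr rfl (fun v _ => h1 v)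
    rw [Finset.sum_add_distrib, Finset.sum_add_distrib] at h2
    simp [hcard] at h2
    unfold Rob.E2
    linarith
  have hm : 2 * G.edgeFinset.card ≤ r * (3 * r - 2) := by omega
  obtain ⟨s, rfl⟩ : ∃ s, r = s + 1 := ⟨r - 1, by omega⟩
  have hs : 3 * (s + 1) - 2 = 3 * s + 1 := by omega
  rw [hs] at hm
  have hex : ∃ A ⊆ (Finset.univ : Finset V), A.card = (Finset.univ : Finset V).card / 2 ∧
      Rob.Good Gᶜ Finset.univ A := by
    rcases s with _ | k
    · have h0 : G.edgeFinset.card = 0 := by omega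
      rw [Finset.card_eq_zero] at h0
      have hno : ∀ a b, ¬ G.Adj a b := by
        intro a b hab
        have : s(a, b) ∈ G.edgeFinset := by simpa using hab
        simp [h0] at this
      obtain ⟨a, b, hab, hu⟩ := Finset.card_eq_two.mp (by
        rw [Finset.card_univ, hcard] : (Finset.univ : Finset V).card = 2)
      refine ⟨{a}, by simp, by rw [Finset.card_univ, hcard]; simp, ?_, ?_⟩
      · intro v hv
        simp at hv
        subst hv
        exact ⟨b, by simp [hab.symm], by simp [hno, hab]⟩
      · intro v hv
        simp at hv
        exact ⟨a, by simp, by simp [hno, hv]⟩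
    · apply Rob.main Gᶜ k Finset.univ
      · rw [Finset.card_univ, hcard]; omega
      · exact hcond
      · rw [Finset.card_univ, hcard]; nlinarith
  obtain ⟨A, _, hAc, hG⟩ := hex
  exact hcut A (by rw [hAc, Finset.card_univ, hcard]; omega) hG
end
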